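/- Consider the two-timescale iteration x_{k+1} = x_k + a_k (f(x_k, p_k) − x_k), p_{k+1} = p_k + β_k ∇Φ(x_k)·1{p_k + β_k ∇Φ(x_k) ∈ 𝒫_c}, started at any (x₀, p₀) ∈ 𝒳 × 𝒫_c with 0 < c < c*. Under the standing assumptions on G₀ and Φ, assume: f : ℝⁿ × ℝⁿ → ℝⁿ maps 𝒳 × 𝒫_c into 𝒳 and is jointly L_f-Lipschitz there; there is a class-𝒦ℒ function φ such that for every p ∈ 𝒫_c, every solution x(t) of ẋ = f(x, p) − x with x(0) ∈ 𝒳 satisfies ‖x(t) − x*(p)‖ ≤ φ(‖x(0) − x*(p)‖, t) for all t ≥ 0; and the step sizes satisfy a_k ∈ (0,1], β_k > 0, Σ_k a_k = Σ_k β_k = ∞, Σ_k (a_k² + β_k²) < ∞, and β_k / a_k → 0. Then ‖x_k − x*(p_k)‖ → 0 and p_k → p† = −G₀(x†) as k → ∞; consequently (x_k, p_k) → (x†, p†). -/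

import Mathlib

open scoped RealInnerProductSpace
open Filter Topology

/-- Symmetrization `(T + Tᵀ)/2` of a continuous linear map on Euclidean space. -/
noncomputable def symCLM {n : ℕ}
    (T : EuclideanSpace ℝ (Fin n) →L[ℝ] EuclideanSpace ℝ (Fin n)) :
    EuclideanSpace ℝ (Fin n) →L[ℝ] EuclideanSpace ℝ (Fin n) :=
  (1 / 2 : ℝ) • (T + ContinuousLinearMap.adjoint T)

/-- A function `φ : [0,∞) × [0,∞) → [0,∞)` of class 𝒦ℒ. -/
def IsClassKL (φ : ℝ → ℝ → ℝ) : Prop :=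
  (∀ r t, 0 ≤ r → 0 ≤ t → 0 ≤ φ r t) ∧
  (∀ t, 0 ≤ t →
    ContinuousOn (fun r => φ r t) (Set.Ici 0) ∧
    StrictMonoOn (fun r => φ r t) (Set.Ici 0) ∧ φ 0 t = 0) ∧
  (∀ r, 0 ≤ r →
    AntitoneOn (fun t => φ r t) (Set.Ici 0) ∧
    Filter.Tendsto (fun t => φ r t) Filter.atTop (nhds 0))
/-- A bounded, globally Lipschitz autonomous vector field on a Banach space has a global integral
curve through every point. -/
theorem exists_global_solution_of_lipschitz_of_bounded {E : Type*} [NormedAddCommGroup E]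
    [NormedSpace ℝ E] [CompleteSpace E] {v : E → E} {K C : NNReal} (hv : LipschitzWith K v)
    (hC : ∀ x, ‖v x‖ ≤ C) (x₀ : E) :
    ∃ ξ : ℝ → E, ξ 0 = x₀ ∧ ∀ t, HasDerivAt ξ (v (ξ t)) t := by
  have hloc : ∀ N : ℕ, ∃ ξ : ℝ → E, ξ 0 = x₀ ∧
      ∀ t ∈ Set.Ioo (-(N : ℝ)) N, HasDerivAt ξ (v (ξ t)) t := by
    intro N
    have h0 : (0 : ℝ) ∈ Set.Icc (-(N : ℝ)) N := by simp
    have hpl : IsPicardLindelof (fun _ => v) (⟨0, h0⟩ : Set.Icc (-(N : ℝ)) N) x₀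
        (C * N) 0 C K := by
      refine IsPicardLindelof.of_time_independent (fun x _ => hC x) hv.lipschitzOnWith ?_
      simp
    obtain ⟨ξ, hξ0, hξ⟩ := hpl.exists_eq_forall_mem_Icc_hasDerivWithinAt₀
    exact ⟨ξ, hξ0, fun t ht =>
      (hξ t (Set.Ioo_subset_Icc_self ht)).hasDerivAt (Icc_mem_nhds ht.1 ht.2)⟩
  choose ξ hξ0 hξ using hloc
  have huniq : ∀ N M : ℕ, N ≤ M → ∀ t ∈ Set.Ioo (-(N : ℝ)) N, ξ N t = ξ M t := by
    intro N M hNM t ht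
    have hNM' : (N : ℝ) ≤ M := by exact_mod_cast hNM
    have hN : (0 : ℝ) < N := by linarith [ht.1, ht.2]
    refine ODE_solution_unique_of_mem_Ioo (v := fun _ => v) (s := fun _ => Set.univ) (K := K)
      (t₀ := 0) (fun _ _ => hv.lipschitzOnWith) ⟨by linarith, hN⟩
      (fun s hs => ⟨hξ N s hs, trivial⟩)
      (fun s hs => ⟨hξ M s ⟨by linarith [hs.1], by linarith [hs.2]⟩, trivial⟩)
      (by rw [hξ0, hξ0]) ht
  have hglue : ∀ (N : ℕ) (t : ℝ), t ∈ Set.Ioo (-(N : ℝ)) N → ξ (⌈|t|⌉₊ + 1) t = ξ N t := by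
    intro N t ht
    have ht' : t ∈ Set.Ioo (-((⌈|t|⌉₊ + 1 : ℕ) : ℝ)) ((⌈|t|⌉₊ + 1 : ℕ) : ℝ) := by
      rw [Set.mem_Ioo, ← abs_lt]
      push_cast
      linarith [Nat.le_ceil |t|]
    rcases le_total N (⌈|t|⌉₊ + 1) with h | h
    · exact (huniq _ _ h t ht).symm
    · exact huniq _ _ h t ht'
  refine ⟨fun t => ξ (⌈|t|⌉₊ + 1) t, hξ0 _, fun t => ?_⟩
  obtain ⟨N, hN⟩ := exists_nat_gt |t|
  have ht : t ∈ Set.Ioo (-(N : ℝ)) N := abs_lt.1 hN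
  have hd := hξ N t ht
  rw [← hglue N t ht] at hd
  refine hd.congr_of_eventuallyEq ?_
  filter_upwards [Ioo_mem_nhds ht.1 ht.2] with s hs using hglue N s hs

/-- A differentiable real function starting below `b` whose derivative is nonpositive wherever the
function is at least `b` stays below `b`. -/
theorem le_of_hasDerivAt_nonpos_of_le {u u' : ℝ → ℝ} {b : ℝ} (h0 : u 0 ≤ b)
    (hu : ∀ t, HasDerivAt u (u' t) t) (hbar : ∀ t, b ≤ u t → u' t ≤ 0) {t : ℝ} (ht : 0 ≤ t) :
    u t ≤ b := by
  have key : ∀ ε > 0, u t ≤ b + ε * t := by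
    intro ε hε
    refine image_le_of_deriv_right_lt_deriv_boundary (a := 0) (b := t)
      (B := fun s => b + ε * s) (B' := fun _ => ε)
      (fun s _ => (hu s).continuousAt.continuousWithinAt)
      (fun s _ => (hu s).hasDerivWithinAt) (by simpa using h0)
      (fun s => by simpa using ((hasDerivAt_id s).const_mul ε).const_add b) ?_ ⟨ht, le_rfl⟩
    intro s hs hus
    have : 0 ≤ ε * s := mul_nonneg hε.le hs.1
    exact (hbar s (by rw [hus]; linarith)).trans_lt hε
  refine le_of_forall_pos_le_add fun δ hδ => (key (δ / (t + 1)) (by positivity)).trans ?_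
  have : δ / (t + 1) * t ≤ δ := by
    rw [div_mul_eq_mul_div, div_le_iff₀ (by positivity)]
    nlinarith
  linarith

/-- The coordinatewise projection of Euclidean space onto the box `∏ [a i, b i]`. -/
noncomputable def boxClamp {n : ℕ} (a b : Fin n → ℝ) (x : EuclideanSpace ℝ (Fin n)) :
    EuclideanSpace ℝ (Fin n) :=
  WithLp.toLp 2 fun i => max (a i) (min (b i) (x i))

theorem boxClamp_apply {n : ℕ} (a b : Fin n → ℝ) (x : EuclideanSpace ℝ (Fin n)) (i : Fin n) :
    boxClamp a b x i = max (a i) (min (b i) (x i)) := rfl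

theorem boxClamp_mem {n : ℕ} {a b : Fin n → ℝ} (hab : ∀ i, a i ≤ b i)
    (x : EuclideanSpace ℝ (Fin n)) (i : Fin n) : boxClamp a b x i ∈ Set.Icc (a i) (b i) :=
  ⟨le_max_left _ _, max_le (hab i) (min_le_left _ _)⟩

theorem boxClamp_of_mem {n : ℕ} {a b : Fin n → ℝ} {x : EuclideanSpace ℝ (Fin n)}
    (hx : ∀ i, x i ∈ Set.Icc (a i) (b i)) : boxClamp a b x = x := by
  ext i
  rw [boxClamp_apply, min_eq_right (hx i).2, max_eq_right (hx i).1]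

theorem lipschitzWith_boxClamp {n : ℕ} (a b : Fin n → ℝ) : LipschitzWith 1 (boxClamp a b) := by
  refine LipschitzWith.of_dist_le_mul fun x y => ?_
  rw [NNReal.coe_one, one_mul, EuclideanSpace.dist_eq, EuclideanSpace.dist_eq]
  refine Real.sqrt_le_sqrt (Finset.sum_le_sum fun i _ => ?_)
  have h : dist (boxClamp a b x i) (boxClamp a b y i) ≤ dist (x i) (y i) := by
    rw [boxClamp_apply, boxClamp_apply, Real.dist_eq, Real.dist_eq]
    refine (abs_max_sub_max_le_max _ _ _ _).trans ?_
    refine max_le (by simp) ((abs_min_sub_min_le_max _ _ _ _).trans (max_le (by simp) le_rfl))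
  gcongr

/-- The relaxation dynamics `ξ' = F ξ - ξ` of a Lipschitz self-map `F` of a box have a solution,
defined for all nonnegative times and staying in the box, from every point of the box. -/
theorem exists_relaxation_flow_mem_box {n : ℕ} {a b : Fin n → ℝ} (hab : ∀ i, a i ≤ b i)
    {X : Set (EuclideanSpace ℝ (Fin n))} (hX : X = {x | ∀ i, x i ∈ Set.Icc (a i) (b i)})
    {F : EuclideanSpace ℝ (Fin n) → EuclideanSpace ℝ (Fin n)} {K : NNReal}
    (hF : LipschitzOnWith K F X) (hFX : Set.MapsTo F X X) (hXb : Bornology.IsBounded X)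
    {x₀ : EuclideanSpace ℝ (Fin n)} (hx₀ : x₀ ∈ X) :
    ∃ ξ : ℝ → EuclideanSpace ℝ (Fin n), ξ 0 = x₀ ∧ (∀ t, 0 ≤ t → ξ t ∈ X) ∧
      ∀ t, 0 ≤ t → HasDerivAt ξ (F (ξ t) - ξ t) t := by
  have hmem : ∀ x, boxClamp a b x ∈ X := fun x => by
    rw [hX]; exact fun i => boxClamp_mem hab x i
  have hFl : LipschitzWith (K * 1) (F ∘ boxClamp a b) := by
    rw [← lipschitzOnWith_univ]
    exact hF.comp (lipschitzWith_boxClamp a b).lipschitzOnWith fun x _ => hmem x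
  have hv := hFl.sub (lipschitzWith_boxClamp a b)
  obtain ⟨R, hR⟩ := hXb.exists_norm_le
  have hR0 : 0 ≤ R := (norm_nonneg _).trans (hR x₀ hx₀)
  obtain ⟨ξ, hξ0, hξ⟩ := exists_global_solution_of_lipschitz_of_bounded hv
    (C := ⟨R + R, by linarith⟩)
    (fun x => (norm_sub_le _ _).trans (add_le_add (hR _ (hFX (hmem x))) (hR _ (hmem x)))) x₀
  have hcoord : ∀ i t, HasDerivAt (fun s => ξ s i)
      (F (boxClamp a b (ξ t)) i - boxClamp a b (ξ t) i) t := by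
    intro i t
    exact (EuclideanSpace.proj (𝕜 := ℝ) i).hasFDerivAt.comp_hasDerivAt t (hξ t)
  have hFmem : ∀ x i, F (boxClamp a b x) i ∈ Set.Icc (a i) (b i) := by
    intro x
    have h := hFX (hmem x)
    rw [hX] at h
    exact h
  have hx₀' : ∀ i, x₀ i ∈ Set.Icc (a i) (b i) := by rw [hX] at hx₀; exact hx₀
  have hbox : ∀ t, 0 ≤ t → ∀ i, ξ t i ∈ Set.Icc (a i) (b i) := by
    intro t ht i
    constructor
    · refine neg_le_neg_iff.1 (le_of_hasDerivAt_nonpos_of_le (u := fun s => -ξ s i)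
        (by simpa [hξ0] using (hx₀' i).1) (fun s => (hcoord i s).neg) ?_ ht)
      intro s hs
      rw [boxClamp_apply _ _ _ i, max_eq_left ((min_le_right _ _).trans (neg_le_neg_iff.1 hs))]
      linarith [(hFmem (ξ s) i).1]
    · refine le_of_hasDerivAt_nonpos_of_le (u := fun s => ξ s i)
        (by simpa [hξ0] using (hx₀' i).2) (hcoord i) ?_ ht
      intro s hs
      rw [boxClamp_apply _ _ _ i, min_eq_left hs, max_eq_right (hab i)]
      linarith [(hFmem (ξ s) i).2]
  refine ⟨ξ, hξ0, fun t ht => by rw [hX]; exact hbox t ht, fun t ht => ?_⟩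
  have h := hξ t
  simp only [Function.comp_apply, boxClamp_of_mem (hbox t ht)] at h
  exact h

/-- One-step consistency of the explicit Euler scheme along a solution of `ξ' = v ξ`. -/
theorem norm_euler_local_error_le {E : Type*} [NormedAddCommGroup E] [NormedSpace ℝ E]
    {X : Set E} {v : E → E} {L : NNReal} {C : ℝ} (hv : LipschitzOnWith L v X)
    (hC : ∀ x ∈ X, ‖v x‖ ≤ C) {ξ : ℝ → E} (hξX : ∀ t, 0 ≤ t → ξ t ∈ X)
    (hξ : ∀ t, 0 ≤ t → HasDerivAt ξ (v (ξ t)) t) {t h : ℝ} (ht : 0 ≤ t) (hh : 0 ≤ h) :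
    ‖ξ (t + h) - ξ t - h • v (ξ t)‖ ≤ L * C * h * h := by
  have hI : ∀ s ∈ Set.Icc t (t + h), 0 ≤ s := fun s hs => ht.trans hs.1
  have htI : t ∈ Set.Icc t (t + h) := ⟨le_rfl, by linarith⟩
  have hC0 : 0 ≤ C := (norm_nonneg _).trans (hC _ (hξX t ht))
  have h1 : ∀ s ∈ Set.Icc t (t + h), ‖ξ s - ξ t‖ ≤ C * h := by
    intro s hs
    refine ((convex_Icc t (t + h)).norm_image_sub_le_of_norm_hasDerivWithin_le
      (fun r hr => (hξ r (hI r hr)).hasDerivWithinAt)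
      (fun r hr => hC _ (hξX r (hI r hr))) htI hs).trans ?_
    refine mul_le_mul_of_nonneg_left ?_ hC0
    rw [Real.norm_of_nonneg (by linarith [hs.1])]
    linarith [hs.2]
  have h2 := (convex_Icc t (t + h)).norm_image_sub_le_of_norm_hasDerivWithin_le
    (f := fun s => ξ s - s • v (ξ t)) (f' := fun s => v (ξ s) - v (ξ t)) (C := L * (C * h))
    (fun s hs => by
      have := (hξ s (hI s hs)).sub ((hasDerivAt_id s).smul_const (v (ξ t)))
      rw [one_smul] at this
      exact this.hasDerivWithinAt)
    (fun s hs => by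
      have := hv.norm_sub_le (hξX s (hI s hs)) (hξX t ht)
      exact this.trans (mul_le_mul_of_nonneg_left (h1 s hs) L.2))
    htI (y := t + h) ⟨by linarith, le_rfl⟩
  rw [add_sub_cancel_left, Real.norm_of_nonneg hh] at h2
  calc ‖ξ (t + h) - ξ t - h • v (ξ t)‖
      = ‖ξ (t + h) - (t + h) • v (ξ t) - (ξ t - t • v (ξ t))‖ := by
        congr 1
        module
    _ ≤ L * (C * h) * h := h2
    _ = L * C * h * h := by ring

/-- Discrete Grönwall estimate for a perturbed explicit Euler scheme with variable steps. -/
theorem norm_euler_sub_flow_le {E : Type*} [NormedAddCommGroup E] [NormedSpace ℝ E]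
    {X : Set E} {v : E → E} {L : NNReal} {C : ℝ} (hv : LipschitzOnWith L v X)
    (hC : ∀ x ∈ X, ‖v x‖ ≤ C) {ξ : ℝ → E} (hξX : ∀ t, 0 ≤ t → ξ t ∈ X)
    (hξ : ∀ t, 0 ≤ t → HasDerivAt ξ (v (ξ t)) t) {y : ℕ → E} (hy0 : ξ 0 = y 0)
    (hyX : ∀ j, y j ∈ X) {α : ℕ → ℝ} {s δ : ℝ} (hδ : 0 ≤ δ) (hα0 : ∀ j, 0 ≤ α j)
    (hαs : ∀ j, α j ≤ s) {N : ℕ}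
    (hy : ∀ j < N, ‖y (j + 1) - y j - α j • v (y j)‖ ≤ α j * δ) :
    ∀ j ≤ N, ‖y j - ξ (∑ i ∈ Finset.range j, α i)‖ ≤
      (∑ i ∈ Finset.range j, α i) * (δ + L * C * s) *
        Real.exp (L * ∑ i ∈ Finset.range j, α i) := by
  intro j
  have hC0 : 0 ≤ C := (norm_nonneg _).trans (hC _ (hyX 0))
  have hs0 : 0 ≤ s := (hα0 0).trans (hαs 0)
  have hL0 : (0 : ℝ) ≤ L := L.2
  induction j with
  | zero => intro; simp [hy0]
  | succ j ih =>
    intro hj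
    have hτ0 : 0 ≤ ∑ i ∈ Finset.range j, α i := Finset.sum_nonneg fun i _ => hα0 i
    have hih := ih (by omega)
    rw [Finset.sum_range_succ]
    set τ := ∑ i ∈ Finset.range j, α i
    have hα := hα0 j
    have hloc := norm_euler_local_error_le hv hC hξX hξ hτ0 hα
    have hlip := hv.norm_sub_le (hyX j) (hξX τ hτ0)
    have hstep := hy j (by omega)
    have hsplit : y (j + 1) - ξ (τ + α j) =
        (y j - ξ τ) + α j • (v (y j) - v (ξ τ)) + (y (j + 1) - y j - α j • v (y j))
          - (ξ (τ + α j) - ξ τ - α j • v (ξ τ)) := by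
      module
    have hnorm : ‖y (j + 1) - ξ (τ + α j)‖ ≤
        ‖y j - ξ τ‖ + α j * (L * ‖y j - ξ τ‖) + α j * δ + L * C * α j * α j := by
      rw [hsplit]
      refine (norm_sub_le _ _).trans (add_le_add ?_ hloc)
      refine (norm_add_le _ _).trans (add_le_add ?_ hstep)
      refine (norm_add_le _ _).trans (add_le_add le_rfl ?_)
      rw [norm_smul, Real.norm_of_nonneg hα]
      exact mul_le_mul_of_nonneg_left hlip hα
    have hB : 0 ≤ δ + L * C * s := by positivity
    have hquad : L * C * α j * α j ≤ α j * (L * C * s) := by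
      have : L * C * α j ≤ L * C * s := mul_le_mul_of_nonneg_left (hαs j) (by positivity)
      nlinarith
    have hexp : 1 + L * α j ≤ Real.exp (L * α j) := by
      linarith [Real.add_one_le_exp (L * α j)]
    have hexp1 : 1 ≤ Real.exp (L * (τ + α j)) := Real.one_le_exp (by positivity)
    calc ‖y (j + 1) - ξ (τ + α j)‖
        ≤ (1 + L * α j) * ‖y j - ξ τ‖ + α j * (δ + L * C * s) := by linarith
      _ ≤ Real.exp (L * α j) * (τ * (δ + L * C * s) * Real.exp (L * τ))
          + α j * (δ + L * C * s) * Real.exp (L * (τ + α j)) := by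
        refine add_le_add ?_ (le_mul_of_one_le_right (by positivity) hexp1)
        gcongr
      _ = (τ + α j) * (δ + L * C * s) * Real.exp (L * (τ + α j)) := by
        rw [mul_add (L : ℝ), Real.exp_add]
        ring

/-- **Fast-timescale tracking.** If the frozen dynamics `ξ' = f ξ p - ξ` approach their equilibrium
`xs p` at a rate uniform in the parameter `p` and in the initial point, then the iterates of the
relaxation `x (k + 1) = x k + a k • (f (x k) (p k) - x k)` approach `xs (p k)` as soon as the
parameter moves on a slower timescale. -/
theorem tendsto_norm_sub_equilibrium {E F : Type*} [NormedAddCommGroup E] [NormedSpace ℝ E]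
    [NormedAddCommGroup F] {X : Set E} {P : Set F} {f : E → F → E} {Lf Ls : NNReal} {C : ℝ}
    (hf : LipschitzOnWith Lf (fun q : E × F => f q.1 q.2) (X ×ˢ P))
    (hC : ∀ x ∈ X, ∀ p ∈ P, ‖f x p - x‖ ≤ C) {xs : F → E} (hxs : LipschitzOnWith Ls xs P)
    {ψ : ℝ → ℝ} (hψ : Tendsto ψ atTop (𝓝 0))
    (hflow : ∀ p ∈ P, ∀ x₀ ∈ X, ∃ ξ : ℝ → E, ξ 0 = x₀ ∧ (∀ t, 0 ≤ t → ξ t ∈ X) ∧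
      (∀ t, 0 ≤ t → HasDerivAt ξ (f (ξ t) p - ξ t) t) ∧
      ∀ t, 0 ≤ t → ‖ξ t - xs p‖ ≤ ψ t)
    {a r : ℕ → ℝ} (ha0 : ∀ k, 0 ≤ a k) (ha1 : ∀ k, a k ≤ 1) (ha : Tendsto a atTop (𝓝 0))
    (hasum : Tendsto (fun N => ∑ k ∈ Finset.range N, a k) atTop atTop)
    (hr : Tendsto r atTop (𝓝 0)) {x : ℕ → E} {p : ℕ → F} (hx : ∀ k, x k ∈ X)
    (hp : ∀ k, p k ∈ P) (hxrec : ∀ k, x (k + 1) = x k + a k • (f (x k) (p k) - x k))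
    (hprec : ∀ k, ‖p (k + 1) - p k‖ ≤ a k * r k) :
    Tendsto (fun k => ‖x k - xs (p k)‖) atTop (𝓝 0) := by
  have hC0 : 0 ≤ C := (norm_nonneg _).trans (hC _ (hx 0) _ (hp 0))
  have hvlip : ∀ q ∈ P, LipschitzOnWith (Lf + 1) (fun z => f z q - z) X := by
    intro q hq
    refine LipschitzOnWith.of_dist_le_mul fun z hz w hw => ?_
    have h1 := hf.dist_le_mul (z, q) ⟨hz, hq⟩ (w, q) ⟨hw, hq⟩
    rw [Prod.dist_eq, dist_self, max_eq_left dist_nonneg] at h1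
    calc dist (f z q - z) (f w q - w) ≤ dist (f z q) (f w q) + dist z w := dist_sub_sub_le _ _ _ _
      _ ≤ Lf * dist z w + dist z w := add_le_add h1 le_rfl
      _ = ((Lf + 1 : NNReal) : ℝ) * dist z w := by push_cast; ring
  have hfp : ∀ z ∈ X, ∀ q ∈ P, ∀ q' ∈ P, ‖f z q - f z q'‖ ≤ Lf * ‖q - q'‖ := by
    intro z hz q hq q' hq'
    have h1 := hf.dist_le_mul (z, q) ⟨hz, hq⟩ (z, q') ⟨hz, hq'⟩
    rwa [Prod.dist_eq, dist_self, max_eq_right dist_nonneg, dist_eq_norm, dist_eq_norm] at h1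
  rw [Metric.tendsto_atTop]
  intro ε hε
  obtain ⟨T₀, hT₀⟩ := eventually_atTop.1 (hψ.eventually_lt_const (show (0 : ℝ) < ε / 3 by positivity))
  set T₁ := max T₀ 0
  have hT₁ : 0 ≤ T₁ := le_max_right _ _
  set T := T₁ + 1 with hT
  have hTpos : 0 < T := by positivity
  set L : NNReal := Lf + 1
  set Q : ℝ := T * (Lf * T + L * C) * Real.exp (L * T) + Ls * T with hQ
  have hQ0 : 0 ≤ Q := by positivity
  set s : ℝ := (ε / 3) / (Q + 1) with hs
  have hspos : 0 < s := by positivity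
  have hsQ : s * Q < ε / 3 := by
    rw [hs, div_mul_eq_mul_div, div_lt_iff₀ (by positivity)]
    nlinarith
  obtain ⟨K, hK⟩ := eventually_atTop.1
    ((ha.eventually_le_const hspos).and (hr.eventually_le_const hspos))
  set t : ℕ → ℝ := fun N => ∑ k ∈ Finset.range N, a k
  have htsucc : ∀ k, t (k + 1) = t k + a k := fun k => Finset.sum_range_succ _ _
  have htmono : Monotone t := monotone_nat_of_le_succ fun k => by
    rw [htsucc]; linarith [ha0 k]
  obtain ⟨J, hJ⟩ := eventually_atTop.1 (hasum.eventually_ge_atTop (t K + T))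
  refine ⟨J, fun j hj => ?_⟩
  rw [Real.dist_eq, sub_zero, abs_of_nonneg (norm_nonneg _)]
  have htj : t K + T ≤ t j := hJ j hj
  have hKj : K ≤ j := by
    by_contra! h
    have := htmono h.le
    linarith
  obtain ⟨k, hKk, hkj, hk1, hk2⟩ : ∃ k, K ≤ k ∧ k ≤ j ∧ T₁ ≤ t j - t k ∧ t j - t k ≤ T := by
    classical
    set k := Nat.findGreatest (fun i => t i ≤ t j - T₁) j
    have hPK : t K ≤ t j - T₁ := by linarith
    have hPk : t k ≤ t j - T₁ :=
      Nat.findGreatest_spec (P := fun i => t i ≤ t j - T₁) hKj hPK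
    have hkj : k ≤ j := Nat.findGreatest_le j
    refine ⟨k, Nat.le_findGreatest hKj hPK, hkj, by linarith, ?_⟩
    rcases hkj.eq_or_lt with h | h
    · rw [h]; linarith
    · have := Nat.findGreatest_is_greatest (P := fun i => t i ≤ t j - T₁)
        (Nat.lt_succ_self k) h
      have h' := htsucc k
      have h'' := ha1 k
      simp only [Nat.succ_eq_add_one, not_le] at this
      linarith
  have hsum : ∀ i, ∑ l ∈ Finset.range i, a (k + l) = t (k + i) - t k := fun i => by
    simp [t, Finset.sum_range_add]
  have hdrift : ∀ i, ‖p (k + i) - p k‖ ≤ s * (t (k + i) - t k) := by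
    intro i
    induction i with
    | zero => simp
    | succ i ih =>
      have h1 := (hprec (k + i)).trans
        (mul_le_mul_of_nonneg_left (hK (k + i) (by omega)).2 (ha0 _))
      have h2 := htsucc (k + i)
      have h3 : ‖p (k + (i + 1)) - p k‖ ≤ ‖p (k + i + 1) - p (k + i)‖ + ‖p (k + i) - p k‖ :=
        norm_sub_le_norm_sub_add_norm_sub _ _ _
      rw [← add_assoc, h2]
      rw [← add_assoc] at h3
      nlinarith
  obtain ⟨ξ, hξ0, hξX, hξ, hξs⟩ := hflow (p k) (hp k) (x k) (hx k)
  obtain ⟨N, rfl⟩ := Nat.exists_eq_add_of_le hkj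
  have hdriftT : ∀ i ≤ N, ‖p (k + i) - p k‖ ≤ s * T := fun i hi =>
    (hdrift i).trans (mul_le_mul_of_nonneg_left
      (by linarith [htmono (show k + i ≤ k + N by omega)]) hspos.le)
  have htrack := norm_euler_sub_flow_le (y := fun i => x (k + i)) (α := fun i => a (k + i))
    (s := s) (δ := Lf * (s * T)) (N := N) (hvlip (p k) (hp k)) (fun z hz => hC z hz _ (hp k))
    hξX hξ hξ0 (fun i => hx _) (by positivity) (fun i => ha0 _)
    (fun i => (hK (k + i) (by omega)).1)
    (fun i hi => by
      have h1 : x (k + (i + 1)) - x (k + i) - a (k + i) • (f (x (k + i)) (p k) - x (k + i)) =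
          a (k + i) • (f (x (k + i)) (p (k + i)) - f (x (k + i)) (p k)) := by
        rw [← add_assoc, hxrec (k + i)]
        module
      rw [h1, norm_smul, Real.norm_of_nonneg (ha0 _)]
      refine mul_le_mul_of_nonneg_left ?_ (ha0 _)
      exact (hfp _ (hx _) _ (hp _) _ (hp _)).trans
        (mul_le_mul_of_nonneg_left (hdriftT i hi.le) Lf.2))
    N le_rfl
  simp only [hsum] at htrack
  set τ := t (k + N) - t k
  have hτ0 : 0 ≤ τ := hT₁.trans hk1
  have h1 : ‖x (k + N) - ξ τ‖ ≤ T * (Lf * (s * T) + L * C * s) * Real.exp (L * T) := by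
    refine htrack.trans ?_
    gcongr
  have h2 : ‖ξ τ - xs (p k)‖ < ε / 3 :=
    (hξs τ hτ0).trans_lt (hT₀ τ ((le_max_left _ _).trans hk1))
  have h3 : ‖xs (p k) - xs (p (k + N))‖ ≤ Ls * (s * T) := by
    refine (hxs.norm_sub_le (hp _) (hp _)).trans ?_
    rw [norm_sub_rev]
    exact mul_le_mul_of_nonneg_left (hdriftT N le_rfl) Ls.2
  have h4 : ‖x (k + N) - xs (p (k + N))‖ ≤
      ‖x (k + N) - ξ τ‖ + ‖ξ τ - xs (p k)‖ + ‖xs (p k) - xs (p (k + N))‖ := by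
    refine (norm_sub_le_norm_sub_add_norm_sub _ (xs (p k)) _).trans (add_le_add ?_ le_rfl)
    exact norm_sub_le_norm_sub_add_norm_sub _ _ _
  have h5 : T * (Lf * (s * T) + L * C * s) * Real.exp (L * T) + Ls * (s * T) = s * Q := by
    rw [hQ]; ring
  linarith

theorem inner_symCLM_self {n : ℕ} (T : EuclideanSpace ℝ (Fin n) →L[ℝ] EuclideanSpace ℝ (Fin n))
    (w : EuclideanSpace ℝ (Fin n)) : ⟪w, symCLM T w⟫ = ⟪w, T w⟫ := by
  simp only [symCLM, smul_apply, add_apply,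
    inner_smul_right, inner_add_right, ContinuousLinearMap.adjoint_inner_right]
  rw [real_inner_comm w (T w)]
  ring

section InnerProductSpace

variable {E : Type*} [NormedAddCommGroup E] [InnerProductSpace ℝ E]

/-- A map whose derivative is uniformly coercive on a convex set is strongly monotone there. -/
theorem mul_norm_sub_sq_le_inner_of_coercive {X : Set E} (hX : Convex ℝ X) {G : E → E}
    {D : E → E →L[ℝ] E} (hG : ∀ x ∈ X, HasFDerivAt G (D x) x) {c : ℝ}
    (hD : ∀ x ∈ X, ∀ w, c * ‖w‖ ^ 2 ≤ ⟪w, D x w⟫) {x y : E} (hx : x ∈ X) (hy : y ∈ X) :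
    c * ‖y - x‖ ^ 2 ≤ ⟪G y - G x, y - x⟫ := by
  obtain ⟨z, hz, h⟩ := domain_mvt (f := fun z => ⟪y - x, G z⟫)
    (f' := fun z => (innerSL ℝ (y - x)).comp (D z))
    (fun z hz => ((innerSL ℝ (y - x)).hasFDerivAt.comp z (hG z hz)).hasFDerivWithinAt) hX hx hy
  have h' : ⟪y - x, G y - G x⟫ = ⟪y - x, D z (y - x)⟫ := by
    rw [inner_sub_right]
    exact h
  rw [real_inner_comm, h']
  exact hD z (hX.segment_subset hx hy hz) _

/-- Quadratic growth of a strongly convex function away from a minimizer. -/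
theorem StrongConvexOn.mul_norm_sub_sq_le {X : Set E} {Φ : E → ℝ} {μ : ℝ}
    (hΦ : StrongConvexOn X μ Φ) {z y : E} (hz : z ∈ X) (hmin : ∀ x ∈ X, Φ z ≤ Φ x) (hy : y ∈ X) :
    μ / 4 * ‖y - z‖ ^ 2 ≤ Φ y - Φ z := by
  obtain ⟨hX, hconv⟩ := hΦ
  have h := hconv hy hz (a := 1 / 2) (b := 1 / 2) (by norm_num) (by norm_num) (by norm_num)
  have h' := hmin _ (hX hy hz (a := 1 / 2) (b := 1 / 2) (by norm_num) (by norm_num)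
    (by norm_num))
  simp only [smul_eq_mul] at h
  linarith

variable [CompleteSpace E]

/-- The descent inequality for a function whose gradient is Lipschitz on a convex set. -/
theorem sub_le_inner_gradient_add {X : Set E} (hX : Convex ℝ X) {Φ : E → ℝ} {g : E → E}
    (hΦ : ∀ x, HasGradientAt Φ (g x) x) {L : NNReal} (hg : LipschitzOnWith L g X) {x y : E}
    (hx : x ∈ X) (hy : y ∈ X) : Φ y - Φ x ≤ ⟪g x, y - x⟫ + L * ‖y - x‖ ^ 2 := by
  obtain ⟨z, hz, h⟩ := domain_mvt (f := Φ)
    (fun z _ => (hΦ z).hasFDerivAt.hasFDerivWithinAt) hX hx hy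
  rw [InnerProductSpace.toDual_apply_apply] at h
  have hzX := hX.segment_subset hx hy hz
  have hzx : ‖z - x‖ ≤ ‖y - x‖ := by
    rw [segment_eq_image'] at hz
    obtain ⟨θ, hθ, rfl⟩ := hz
    rw [add_sub_cancel_left, norm_smul, Real.norm_of_nonneg hθ.1]
    exact mul_le_of_le_one_left (norm_nonneg _) hθ.2
  have h1 : ⟪g z - g x, y - x⟫ ≤ L * ‖y - x‖ ^ 2 := by
    refine (real_inner_le_norm _ _).trans ?_
    rw [pow_two, ← mul_assoc]
    refine mul_le_mul_of_nonneg_right ((hg.norm_sub_le hzX hx).trans ?_) (norm_nonneg _)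
    exact mul_le_mul_of_nonneg_left hzx L.2
  rw [inner_sub_left] at h1
  rw [h]
  linarith

/-- The first-order characterization of convexity. -/
theorem ConvexOn.sub_le_inner_gradient {X : Set E} {Φ : E → ℝ} (hΦc : ConvexOn ℝ X Φ) {g x y : E}
    (hΦ : HasGradientAt Φ g x) (hx : x ∈ X) (hy : y ∈ X) : Φ x - Φ y ≤ ⟪g, x - y⟫ := by
  have hline : HasDerivAt (fun t : ℝ => AffineMap.lineMap x y t) (y - x) 0 :=
    AffineMap.hasDerivAt_lineMap
  have hd : HasDerivAt (Φ ∘ fun t : ℝ => AffineMap.lineMap x y t) ⟪g, y - x⟫ 0 := by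
    have hΦ' : HasFDerivAt Φ (InnerProductSpace.toDual ℝ E g)
        ((fun t : ℝ => AffineMap.lineMap x y t) 0) := by
      simpa using hΦ.hasFDerivAt
    exact hΦ'.comp_hasDerivAt 0 hline
  have hconv := hΦc.comp_affineMap (AffineMap.lineMap (k := ℝ) x y)
  have h := hconv.le_slope_of_hasDerivAt (x := 0) (y := 1) (by simpa using hx) (by simpa using hy)
    one_pos hd
  simp only [slope_def_field, Function.comp_apply, AffineMap.lineMap_apply_one,
    AffineMap.lineMap_apply_zero, sub_zero, div_one] at h
  rw [← neg_sub y x, inner_neg_right]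
  linarith

/-- Decrease of a convex cost `Φ` when the strongly monotone Lipschitz map `G` is moved by a step
`-β • g x`, where `g x` is the gradient evaluated at an approximation `x` of the current point. -/
theorem exists_cost_decrease {X : Set E} (hX : Convex ℝ X) (hXb : Bornology.IsBounded X)
    {G : E → E} {Λ : NNReal} (hGl : LipschitzOnWith Λ G X) {c : ℝ} (hc : 0 < c)
    (hGm : ∀ x ∈ X, ∀ y ∈ X, c * ‖y - x‖ ^ 2 ≤ ⟪G y - G x, y - x⟫)
    {Φ : E → ℝ} {g : E → E} (hΦ : ∀ x, HasGradientAt Φ (g x) x) (hΦc : ConvexOn ℝ X Φ)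
    {L : NNReal} (hg : LipschitzOnWith L g X) {M : ℝ} (hM : ∀ x ∈ X, ‖g x‖ ≤ M)
    {z : E} (hz : z ∈ X) (hmin : ∀ x ∈ X, Φ z ≤ Φ x) :
    ∃ κ > 0, ∃ A B : ℝ, 0 ≤ A ∧ 0 ≤ B ∧ ∀ x ∈ X, ∀ y ∈ X, ∀ y' ∈ X, ∀ β > 0,
      G y' = G y - β • g x →
      Φ y' ≤ Φ y - β * (κ * (Φ y - Φ z) ^ 2 - (A * ‖x - y‖ + B * β)) := by
  obtain ⟨R, hR⟩ := hXb.exists_norm_le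
  have hM0 : 0 ≤ M := (norm_nonneg _).trans (hM z hz)
  have hR0 : 0 ≤ R := (norm_nonneg _).trans (hR z hz)
  set D : ℝ := R + R + 1
  have hD : 0 < D := by positivity
  set l : ℝ := Λ + 1
  have hl : 0 < l := by positivity
  have hL0 : (0 : ℝ) ≤ L := L.2
  refine ⟨c / l ^ 2 / D ^ 2, by positivity, c / l ^ 2 * (2 * M * L) + L * (M / c),
    L * (M / c) ^ 2, by positivity, by positivity, ?_⟩
  intro x hx y hy y' hy' β hβ hG
  have hmono := hGm y hy y' hy'
  have hGd : G y' - G y = -(β • g x) := by rw [hG]; abel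
  rw [hGd, inner_neg_left, real_inner_smul_left] at hmono
  have hlip : β * ‖g x‖ ≤ l * ‖y' - y‖ := by
    have h := hGl.norm_sub_le hy' hy
    rw [hGd, norm_neg, norm_smul, Real.norm_of_nonneg hβ.le] at h
    refine h.trans (mul_le_mul_of_nonneg_right (by simp [l]) (norm_nonneg _))
  have hdesc := sub_le_inner_gradient_add hX hΦ hg hy hy'
  have hgxy : ‖g y - g x‖ ≤ L * ‖x - y‖ := by
    rw [norm_sub_rev]; exact hg.norm_sub_le hx hy
  have hVle : Φ y - Φ z ≤ ‖g y‖ * D := by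
    refine (hΦc.sub_le_inner_gradient (hΦ y) hy hz).trans ((real_inner_le_norm _ _).trans ?_)
    refine mul_le_mul_of_nonneg_left ?_ (norm_nonneg _)
    have := norm_sub_le y z
    linarith [hR y hy, hR z hz]
  have hcross : ⟪g y - g x, y' - y⟫ ≤ L * ‖x - y‖ * ‖y' - y‖ :=
    (real_inner_le_norm _ _).trans (mul_le_mul_of_nonneg_right hgxy (norm_nonneg _))
  rw [inner_sub_left] at hcross
  have hV0 : 0 ≤ (Φ y - Φ z) / D := div_nonneg (sub_nonneg.2 (hmin y hy)) hD.le
  have hV1 : (Φ y - Φ z) / D ≤ ‖g y‖ := (div_le_iff₀ hD).2 hVle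
  have hCS : -⟪g x, y' - y⟫ ≤ ‖g x‖ * ‖y' - y‖ := by
    rw [← inner_neg_left, ← norm_neg (g x)]; exact real_inner_le_norm _ _
  have hgy : ‖g y‖ ≤ ‖g x‖ + L * ‖x - y‖ := by
    have := norm_sub_norm_le (g y) (g x)
    linarith
  have hMx := hM x hx
  have hMy := hM y hy
  have he0 : 0 ≤ L * ‖x - y‖ := by positivity
  have hκ : c / l ^ 2 / D ^ 2 * (Φ y - Φ z) ^ 2 = c / l ^ 2 * ((Φ y - Φ z) / D) ^ 2 := by
    field_simp
  rw [hκ]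
  set W := (Φ y - Φ z) / D
  set d := ‖y' - y‖
  have hd0 : 0 ≤ d := norm_nonneg _
  have hγ0 : 0 ≤ ‖g x‖ := norm_nonneg _
  have hdM : d ≤ M / c * β := by
    rcases hd0.eq_or_lt with h | h
    · rw [← h]; positivity
    · rw [div_mul_eq_mul_div, le_div_iff₀ hc]
      have h1 : c * d ^ 2 ≤ β * (M * d) := by
        have : ‖g x‖ * d ≤ M * d := mul_le_mul_of_nonneg_right hMx hd0
        nlinarith
      have h2 : (d * c) * d ≤ (M * β) * d := by linarith
      exact le_of_mul_le_mul_right h2 h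
  have hgx : W ^ 2 - 2 * M * (L * ‖x - y‖) ≤ ‖g x‖ ^ 2 := by
    rcases le_total W (L * ‖x - y‖) with h | h
    · nlinarith [sq_nonneg ‖g x‖]
    · nlinarith
  have hmain : ⟪g x, y' - y⟫ ≤ -(β * (c / l ^ 2 * ‖g x‖ ^ 2)) := by
    have h1 : (β * ‖g x‖) ^ 2 ≤ (l * d) ^ 2 := by gcongr
    have h2 : c / l ^ 2 * (β * ‖g x‖) ^ 2 ≤ c * d ^ 2 := by
      rw [div_mul_eq_mul_div, div_le_iff₀ (by positivity)]
      nlinarith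
    have h3 : β * (β * (c / l ^ 2 * ‖g x‖ ^ 2)) ≤ β * -⟪g x, y' - y⟫ := by
      calc β * (β * (c / l ^ 2 * ‖g x‖ ^ 2)) = c / l ^ 2 * (β * ‖g x‖) ^ 2 := by ring
        _ ≤ c * d ^ 2 := h2
        _ ≤ β * -⟪g x, y' - y⟫ := by linarith
    linarith [le_of_mul_le_mul_left h3 hβ]
  have hgx' : β * (c / l ^ 2 * (W ^ 2 - 2 * M * (L * ‖x - y‖))) ≤
      β * (c / l ^ 2 * ‖g x‖ ^ 2) := by gcongr
  have hd1 : L * ‖x - y‖ * d ≤ L * ‖x - y‖ * (M / c * β) := by gcongr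
  have hd2 : L * d ^ 2 ≤ L * (M / c * β) ^ 2 := by gcongr
  have hfin : β * (c / l ^ 2 * W ^ 2 - ((c / l ^ 2 * (2 * M * L) + L * (M / c)) * ‖x - y‖
        + L * (M / c) ^ 2 * β)) =
      β * (c / l ^ 2 * (W ^ 2 - 2 * M * (L * ‖x - y‖))) - L * ‖x - y‖ * (M / c * β)
        - L * (M / c * β) ^ 2 := by ring
  rw [hfin]
  linarith

end InnerProductSpace

/-- A deterministic Robbins–Siegmund type lemma: a nonnegative sequence with drift
`-b (κ V² - ω)`, vanishing perturbation `ω` and non-summable vanishing steps `b`, tends to `0`. -/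
theorem tendsto_zero_of_quadratic_drift {V b ω : ℕ → ℝ} {κ : ℝ} (hκ : 0 < κ) (hV : ∀ k, 0 ≤ V k)
    (hb0 : ∀ k, 0 ≤ b k) (hb : Tendsto b atTop (𝓝 0))
    (hbsum : Tendsto (fun N => ∑ k ∈ Finset.range N, b k) atTop atTop)
    (hω : Tendsto ω atTop (𝓝 0))
    (hstep : ∀ᶠ k in atTop, V (k + 1) ≤ V k - b k * (κ * V k ^ 2 - ω k)) :
    Tendsto V atTop (𝓝 0) := by
  rw [Metric.tendsto_atTop]
  intro ε hε
  set η := ε / 3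
  have hη : 0 < η := by positivity
  obtain ⟨K, hK⟩ := eventually_atTop.1 (hstep.and
    ((hω.eventually_le_const (show 0 < κ * η ^ 2 / 2 by positivity)).and
      ((by simpa using hb.mul hω : Tendsto (fun k => b k * ω k) atTop (𝓝 0)).eventually_le_const
        hη)))
  have hdec : ∀ k, K ≤ k → η ≤ V k → V (k + 1) ≤ V k - b k * (κ * η ^ 2 / 2) := by
    intro k hk hVk
    obtain ⟨h1, h2, -⟩ := hK k hk
    have h3 : κ * η ^ 2 ≤ κ * V k ^ 2 := by gcongr
    have h4 : b k * (κ * η ^ 2 / 2) ≤ b k * (κ * V k ^ 2 - ω k) :=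
      mul_le_mul_of_nonneg_left (by linarith) (hb0 k)
    linarith
  obtain ⟨J, hKJ, hJ⟩ : ∃ J, K ≤ J ∧ V J < η := by
    by_contra! hcon
    have hall : ∀ N, V (K + N) ≤ V K -
        (∑ k ∈ Finset.range (K + N), b k - ∑ k ∈ Finset.range K, b k) * (κ * η ^ 2 / 2) := by
      intro N
      induction N with
      | zero => simp
      | succ N ih =>
        have := hdec (K + N) (by omega) (hcon _ (by omega))
        rw [← add_assoc, Finset.sum_range_succ]
        linarith
    have hlim := (tendsto_atTop_add_const_right _ (-∑ k ∈ Finset.range K, b k)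
      hbsum).atTop_mul_const (show 0 < κ * η ^ 2 / 2 by positivity)
    obtain ⟨N, hN, hNK⟩ := ((hlim.eventually_gt_atTop (V K)).and (eventually_ge_atTop K)).exists
    obtain ⟨N, rfl⟩ := Nat.exists_eq_add_of_le hNK
    have h1 := hall N
    have h2 := hV (K + N)
    simp only [← sub_eq_add_neg] at hN
    linarith
  refine ⟨J, fun k hk => ?_⟩
  rw [Real.dist_eq, sub_zero, abs_of_nonneg (hV k)]
  have hinv : V k ≤ 2 * η := by
    induction k, hk using Nat.le_induction with
    | base => linarith
    | succ k hk ih =>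
      rcases le_total η (V k) with h | h
      · have h1 := hdec k (hKJ.trans hk) h
        have h2 : 0 ≤ b k * (κ * η ^ 2 / 2) := mul_nonneg (hb0 k) (by positivity)
        linarith
      · obtain ⟨h1, -, h3⟩ := hK k (hKJ.trans hk)
        have h4 : 0 ≤ b k * (κ * V k ^ 2) := mul_nonneg (hb0 k) (by positivity)
        linarith
  linarith [show 3 * η = ε by simp only [η]; ring]

/-- The image of an open set under a continuously differentiable map with coercive derivative is
open. -/
theorem isOpen_image_of_coercive {E : Type*} [NormedAddCommGroup E] [InnerProductSpace ℝ E]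
    [FiniteDimensional ℝ E] {O : Set E} (hO : IsOpen O) {G : E → E} {D : E → E →L[ℝ] E}
    (hG : ∀ x ∈ O, HasFDerivAt G (D x) x) (hDc : ContinuousOn D O) {c : ℝ} (hc : 0 < c)
    (hD : ∀ x ∈ O, ∀ w, c * ‖w‖ ^ 2 ≤ ⟪w, D x w⟫) : IsOpen (G '' O) := by
  have : CompleteSpace E := FiniteDimensional.complete ℝ E
  rw [isOpen_iff_mem_nhds]
  rintro _ ⟨x, hx, rfl⟩
  have hstrict : HasStrictFDerivAt G (D x) x :=
    hasStrictFDerivAt_of_hasFDerivAt_of_continuousAt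
      (Filter.mem_of_superset (hO.mem_nhds hx) hG) (hDc.continuousAt (hO.mem_nhds hx))
  have hinj : Function.Injective (D x : E →ₗ[ℝ] E) := by
    rw [← LinearMap.ker_eq_bot, LinearMap.ker_eq_bot']
    intro w hw
    have h := hD x hx w
    rw [show D x w = 0 from hw, inner_zero_right] at h
    have h' : ‖w‖ ^ 2 ≤ 0 := by nlinarith
    simpa using le_antisymm h' (sq_nonneg _)
  have hsurj := LinearMap.range_eq_top.2 (LinearMap.injective_iff_surjective.1 hinj)
  rw [← hstrict.map_nhds_eq_of_surj hsurj]
  exact image_mem_map (hO.mem_nhds hx)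

theorem stmt16 {n : ℕ} (a b : Fin n → ℝ) (hab : ∀ i, a i < b i)
    (𝒳 : Set (EuclideanSpace ℝ (Fin n)))
    (h𝒳 : 𝒳 = {x : EuclideanSpace ℝ (Fin n) | ∀ i, x i ∈ Set.Icc (a i) (b i)})
    (G₀ : EuclideanSpace ℝ (Fin n) → EuclideanSpace ℝ (Fin n))
    (DG₀ : EuclideanSpace ℝ (Fin n) →
      EuclideanSpace ℝ (Fin n) →L[ℝ] EuclideanSpace ℝ (Fin n))
    (U : Set (EuclideanSpace ℝ (Fin n))) (hU : IsOpen U) (hXU : 𝒳 ⊆ U)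
    (hG₀ : ∀ x ∈ U, HasFDerivAt G₀ (DG₀ x) x)
    (m : ℝ) (hm : 0 < m)
    (hsym : ∀ x ∈ 𝒳, ∀ w, ⟪w, symCLM (DG₀ x) w⟫ ≥ m / 2 * ‖w‖ ^ 2)
    (L₁ : ℝ) (hDG₀lip : ∀ x ∈ 𝒳, ∀ y ∈ 𝒳, ‖DG₀ x - DG₀ y‖ ≤ L₁ * ‖x - y‖)
    -- `x*` is the response map: the inverse of `x ↦ −G₀(x)` from `int 𝒳` onto `𝒫`
    (xstar : EuclideanSpace ℝ (Fin n) → EuclideanSpace ℝ (Fin n))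
    (hmaps : Set.MapsTo xstar ((fun x => -G₀ x) '' interior 𝒳) (interior 𝒳))
    (hinv₁ : ∀ p ∈ (fun x => -G₀ x) '' interior 𝒳, G₀ (xstar p) = -p)
    (hinv₂ : ∀ x ∈ interior 𝒳, xstar (-G₀ x) = x)
    -- the planner's social cost `Φ`
    (Φ : EuclideanSpace ℝ (Fin n) → ℝ)
    (gradΦ : EuclideanSpace ℝ (Fin n) → EuclideanSpace ℝ (Fin n))
    (hΦ : ∀ x, HasGradientAt Φ (gradΦ x) x)
    (μΦ : ℝ) (hμΦ : 0 < μΦ) (hΦconv : StrongConvexOn 𝒳 μΦ Φ)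
    (L₂ : NNReal) (hΦlip : LipschitzOnWith L₂ gradΦ 𝒳)
    (xdag : EuclideanSpace ℝ (Fin n)) (hxdag : xdag ∈ interior 𝒳)
    (hmin : ∀ x ∈ 𝒳, Φ xdag ≤ Φ x)
    -- the sublevel set `𝒫_c` with `0 < c < c*`
    (c : ℝ) (hc0 : 0 < c) (hcstar : c < sInf ((fun x => Φ x - Φ xdag) '' frontier 𝒳))
    (Pc : Set (EuclideanSpace ℝ (Fin n)))
    (hPc : Pc = {p ∈ (fun x => -G₀ x) '' interior 𝒳 | Φ (xstar p) - Φ xdag ≤ c})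
    -- the agents' learning dynamics `f`
    (f : EuclideanSpace ℝ (Fin n) → EuclideanSpace ℝ (Fin n) → EuclideanSpace ℝ (Fin n))
    (hfmaps : ∀ x ∈ 𝒳, ∀ p ∈ Pc, f x p ∈ 𝒳)
    (Lf : NNReal)
    (hflip : LipschitzOnWith Lf
      (fun q : EuclideanSpace ℝ (Fin n) × EuclideanSpace ℝ (Fin n) => f q.1 q.2) (𝒳 ×ˢ Pc))
    (φ : ℝ → ℝ → ℝ) (hφ : IsClassKL φ)
    (hKL : ∀ p ∈ Pc, ∀ ξ : ℝ → EuclideanSpace ℝ (Fin n), ξ 0 ∈ 𝒳 →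
      (∀ t : ℝ, 0 ≤ t → HasDerivAt ξ (f (ξ t) p - ξ t) t) →
      ∀ t : ℝ, 0 ≤ t → ‖ξ t - xstar p‖ ≤ φ ‖ξ 0 - xstar p‖ t)
    -- step sizes
    (ak βk : ℕ → ℝ) (hak : ∀ k, ak k ∈ Set.Ioc (0 : ℝ) 1) (hbk : ∀ k, 0 < βk k)
    (haksum : Tendsto (fun N => ∑ k ∈ Finset.range N, ak k) atTop atTop)
    (hbksum : Tendsto (fun N => ∑ k ∈ Finset.range N, βk k) atTop atTop)
    (hsq : Summable (fun k => ak k ^ 2 + βk k ^ 2))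
    (hratio : Tendsto (fun k => βk k / ak k) atTop (𝓝 0))
    -- the two-timescale iteration
    (x p : ℕ → EuclideanSpace ℝ (Fin n)) (hx0 : x 0 ∈ 𝒳) (hp0 : p 0 ∈ Pc)
    (hxrec : ∀ k, x (k + 1) = x k + ak k • (f (x k) (p k) - x k))
    (hprec : ∀ k, p (k + 1) = p k +
      Set.indicator Pc (fun _ => βk k • gradΦ (x k)) (p k + βk k • gradΦ (x k))) :
    Tendsto (fun k => ‖x k - xstar (p k)‖) atTop (𝓝 0) ∧
    Tendsto p atTop (𝓝 (-G₀ xdag)) ∧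
    Tendsto x atTop (𝓝 xdag) := by
  have hXc : Convex ℝ 𝒳 := by
    have : 𝒳 = ⋂ i, (EuclideanSpace.proj (𝕜 := ℝ) i) ⁻¹' Set.Icc (a i) (b i) := by
      rw [h𝒳]; ext z; simp
    rw [this]
    exact convex_iInter fun i =>
      (convex_Icc (a i) (b i)).linear_preimage (EuclideanSpace.proj (𝕜 := ℝ) i).toLinearMap
  have hXcomp : IsCompact 𝒳 := by
    have : 𝒳 = (EuclideanSpace.equiv (Fin n) ℝ).toHomeomorph ⁻¹'
        Set.univ.pi fun i => Set.Icc (a i) (b i) := by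
      rw [h𝒳]; ext z; simp [-Set.pi_univ_Icc, Set.mem_pi]
    rw [this, Homeomorph.isCompact_preimage]
    exact isCompact_univ_pi fun i => isCompact_Icc
  have hXb := hXcomp.isBounded
  have hIX : interior 𝒳 ⊆ 𝒳 := interior_subset
  have hdagX : xdag ∈ 𝒳 := hIX hxdag
  have hm2 : 0 < m / 2 := by positivity
  have hGX : ∀ z ∈ 𝒳, HasFDerivAt G₀ (DG₀ z) z := fun z hz => hG₀ z (hXU hz)
  have hcoer : ∀ z ∈ 𝒳, ∀ w, m / 2 * ‖w‖ ^ 2 ≤ ⟪w, DG₀ z w⟫ := fun z hz w => by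
    rw [← inner_symCLM_self]; exact hsym z hz w
  have hmono : ∀ z ∈ 𝒳, ∀ w ∈ 𝒳, m / 2 * ‖w - z‖ ^ 2 ≤ ⟪G₀ w - G₀ z, w - z⟫ :=
    fun z hz w hw => mul_norm_sub_sq_le_inner_of_coercive hXc hGX hcoer hz hw
  have hDlip : LipschitzOnWith L₁.toNNReal DG₀ 𝒳 :=
    LipschitzOnWith.of_dist_le_mul fun z hz w hw => by
      rw [dist_eq_norm, dist_eq_norm]
      exact (hDG₀lip z hz w hw).trans
        (mul_le_mul_of_nonneg_right (Real.le_coe_toNNReal L₁) (norm_nonneg _))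
  obtain ⟨Λ, hΛ⟩ := hXcomp.exists_bound_of_continuousOn hDlip.continuousOn
  have hGlip : LipschitzOnWith Λ.toNNReal G₀ 𝒳 :=
    hXc.lipschitzOnWith_of_nnnorm_hasFDerivWithin_le
      (fun z hz => (hGX z hz).hasFDerivWithinAt) fun z hz => by
        rw [← NNReal.coe_le_coe, coe_nnnorm]
        exact (hΛ z hz).trans (Real.le_coe_toNNReal Λ)
  obtain ⟨M, hM⟩ := hXcomp.exists_bound_of_continuousOn hΦlip.continuousOn
  have hM0 : 0 ≤ M := (norm_nonneg _).trans (hM xdag hdagX)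
  have hΦcont : Continuous Φ :=
    continuous_iff_continuousAt.2 fun z => (hΦ z).hasFDerivAt.continuousAt
  have hΦcvx : ConvexOn ℝ 𝒳 Φ := (hΦconv.strictConvexOn hμΦ).convexOn
  have hPcP : Pc ⊆ (fun z => -G₀ z) '' interior 𝒳 := by rw [hPc]; exact fun q hq => hq.1
  have hPopen : IsOpen ((fun z => -G₀ z) '' interior 𝒳) := by
    have h := isOpen_image_of_coercive isOpen_interior (fun z hz => hGX z (hIX hz))
      (hDlip.continuousOn.mono hIX) hm2 (fun z hz => hcoer z (hIX hz))
    rw [show (fun z => -G₀ z) '' interior 𝒳 = Homeomorph.neg _ '' (G₀ '' interior 𝒳) by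
      rw [Set.image_image]; rfl]
    exact (Homeomorph.neg _).isOpenMap _ h
  have hsub : ∀ z ∈ 𝒳, Φ z - Φ xdag ≤ c → z ∈ interior 𝒳 := by
    intro z hz hzc
    by_contra hzi
    have hzf : z ∈ frontier 𝒳 := ⟨subset_closure hz, hzi⟩
    have : sInf ((fun w => Φ w - Φ xdag) '' frontier 𝒳) ≤ Φ z - Φ xdag := by
      refine csInf_le ⟨0, ?_⟩ ⟨z, hzf, rfl⟩
      rintro _ ⟨w, hw, rfl⟩
      exact sub_nonneg.2 (hmin w (hXcomp.isClosed.frontier_subset hw))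
    linarith
  have hPceq : Pc = (fun z => -G₀ z) '' (𝒳 ∩ {z | Φ z - Φ xdag ≤ c}) := by
    rw [hPc]
    ext q
    constructor
    · rintro ⟨⟨z, hz, rfl⟩, hzc⟩
      rw [hinv₂ z hz] at hzc
      exact ⟨z, ⟨hIX hz, hzc⟩, rfl⟩
    · rintro ⟨z, ⟨hz, hzc⟩, rfl⟩
      have hzi := hsub z hz hzc
      refine ⟨⟨z, hzi, rfl⟩, ?_⟩
      rwa [hinv₂ z hzi]
  have hPccomp : IsCompact Pc := by
    rw [hPceq]
    refine (hXcomp.inter_right (isClosed_le (by fun_prop) continuous_const)).image_of_continuousOn ?_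
    exact (hGlip.continuousOn.mono Set.inter_subset_left).neg
  have hxsint : ∀ q ∈ Pc, xstar q ∈ interior 𝒳 := fun q hq => hmaps (hPcP hq)
  have hxsX : ∀ q ∈ Pc, xstar q ∈ 𝒳 := fun q hq => hIX (hxsint q hq)
  have hGxs : ∀ q ∈ Pc, G₀ (xstar q) = -q := fun q hq => hinv₁ q (hPcP hq)
  have hxslip : LipschitzOnWith (m / 2).toNNReal⁻¹ xstar Pc := by
    refine LipschitzOnWith.of_dist_le_mul fun q hq q' hq' => ?_
    rw [dist_eq_norm, dist_eq_norm, NNReal.coe_inv, Real.coe_toNNReal _ hm2.le,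
      inv_mul_eq_div, le_div_iff₀ hm2]
    have h := (hmono _ (hxsX q' hq') _ (hxsX q hq)).trans (real_inner_le_norm _ _)
    rw [hGxs q hq, hGxs q' hq', neg_sub_neg, norm_sub_rev q' q] at h
    rcases (norm_nonneg (xstar q - xstar q')).eq_or_lt with h0 | h0
    · rw [← h0]; simp
    · refine le_of_mul_le_mul_right ?_ h0
      linarith
  have hpP : ∀ k, p k ∈ Pc := by
    intro k
    induction k with
    | zero => exact hp0
    | succ k ih =>
      rw [hprec k]
      by_cases h : p k + βk k • gradΦ (x k) ∈ Pc
      · rwa [Set.indicator_of_mem h]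
      · rwa [Set.indicator_of_notMem h, add_zero]
  have hxX : ∀ k, x k ∈ 𝒳 := by
    intro k
    induction k with
    | zero => exact hx0
    | succ k ih =>
      rw [hxrec k]
      exact hXc.add_smul_sub_mem ih (hfmaps _ ih _ (hpP k)) ⟨(hak k).1.le, (hak k).2⟩
  have hsq0 := hsq.tendsto_atTop_zero
  have ha0 : Tendsto ak atTop (𝓝 0) := by
    have h : Tendsto (fun k => ak k ^ 2) atTop (𝓝 0) :=
      squeeze_zero (fun k => sq_nonneg _) (fun k => by nlinarith [sq_nonneg (βk k)]) hsq0
    simpa [Real.sqrt_sq (hak _).1.le] using h.sqrt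
  have hb0 : Tendsto βk atTop (𝓝 0) := by
    have h : Tendsto (fun k => βk k ^ 2) atTop (𝓝 0) :=
      squeeze_zero (fun k => sq_nonneg _) (fun k => by nlinarith [sq_nonneg (ak k)]) hsq0
    simpa [Real.sqrt_sq (hbk _).le] using h.sqrt
  obtain ⟨R, hR⟩ := hXb.exists_norm_le
  have hR0 : 0 ≤ R := (norm_nonneg _).trans (hR xdag hdagX)
  have htrack : Tendsto (fun k => ‖x k - xstar (p k)‖) atTop (𝓝 0) := by
    refine tendsto_norm_sub_equilibrium (C := R + R) (ψ := φ (R + R))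
      (r := fun k => M * (βk k / ak k)) hflip
      (fun z hz q hq => (norm_sub_le _ _).trans
        (add_le_add (hR _ (hfmaps z hz q hq)) (hR z hz)))
      hxslip (hφ.2.2 (R + R) (by positivity)).2 ?_ (fun k => (hak k).1.le) (fun k => (hak k).2)
      ha0 haksum (by simpa using hratio.const_mul M) hxX hpP hxrec ?_
    · intro q hq z hz
      have hlip : LipschitzOnWith Lf (fun w => f w q) 𝒳 := by
        refine LipschitzOnWith.of_dist_le_mul fun w hw w' hw' => ?_
        have h := hflip.dist_le_mul (w, q) ⟨hw, hq⟩ (w', q) ⟨hw', hq⟩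
        rwa [Prod.dist_eq, dist_self, max_eq_left dist_nonneg] at h
      obtain ⟨ξ, hξ0, hξX, hξ⟩ := exists_relaxation_flow_mem_box (fun i => (hab i).le) h𝒳 hlip
        (fun w hw => hfmaps w hw q hq) hXb hz
      refine ⟨ξ, hξ0, hξX, hξ, fun t ht => ?_⟩
      refine (hKL q hq ξ (hξ0 ▸ hz) hξ t ht).trans ?_
      have hdist : ‖ξ 0 - xstar q‖ ≤ R + R :=
        (norm_sub_le _ _).trans (add_le_add (hR _ (hξX 0 le_rfl)) (hR _ (hxsX q hq)))
      exact (hφ.2.1 t ht).2.1.monotoneOn (norm_nonneg _) ((norm_nonneg _).trans hdist) hdist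
    · intro k
      have hstep : ‖p (k + 1) - p k‖ ≤ ‖βk k • gradΦ (x k)‖ := by
        rw [hprec k, add_sub_cancel_left]
        exact norm_indicator_le_norm_self _ _
      have ha := (hak k).1.ne'
      calc ‖p (k + 1) - p k‖ ≤ ‖βk k • gradΦ (x k)‖ := hstep
        _ = βk k * ‖gradΦ (x k)‖ := by rw [norm_smul, Real.norm_of_nonneg (hbk k).le]
        _ ≤ βk k * M := mul_le_mul_of_nonneg_left (hM _ (hxX k)) (hbk k).le
        _ = ak k * (M * (βk k / ak k)) := by field_simp
  obtain ⟨κ, hκ, A, B, hA, hB, hdecr⟩ := exists_cost_decrease hXc hXb hGlip hm2 hmono hΦ hΦcvx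
    hΦlip hM hdagX hmin
  set ω : ℕ → ℝ := fun k => A * ‖x k - xstar (p k)‖ + B * βk k
  have hω0 : Tendsto ω atTop (𝓝 0) := by
    simpa using (htrack.const_mul A).add (hb0.const_mul B)
  have hVc : ∀ k, Φ (xstar (p k)) - Φ xdag ≤ c := fun k => by
    have := hpP k
    rw [hPc] at this
    exact this.2
  obtain ⟨δ, hδ, hthick⟩ := hPccomp.exists_thickening_subset_open hPopen hPcP
  have haccept : ∀ᶠ k in atTop, p k + βk k • gradΦ (x k) ∈ Pc := by
    have hbM : ∀ᶠ k in atTop, βk k * M < δ :=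
      (by simpa using hb0.mul_const M : Tendsto (fun k => βk k * M) atTop (𝓝 0)).eventually_lt_const
        hδ
    have hbω : ∀ᶠ k in atTop, βk k * ω k ≤ c / 2 :=
      (by simpa using hb0.mul hω0 :
        Tendsto (fun k => βk k * ω k) atTop (𝓝 0)).eventually_le_const (by positivity)
    filter_upwards [hbM, hbω,
      hω0.eventually_le_const (show 0 < κ * (c / 2) ^ 2 by positivity)] with k h1 h2 h3
    have hP : p k + βk k • gradΦ (x k) ∈ (fun z => -G₀ z) '' interior 𝒳 := by
      refine hthick (Metric.mem_thickening_iff.2 ⟨p k, hpP k, ?_⟩)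
      rw [dist_eq_norm, add_sub_cancel_left, norm_smul, Real.norm_of_nonneg (hbk k).le]
      exact (mul_le_mul_of_nonneg_left (hM _ (hxX k)) (hbk k).le).trans_lt h1
    have hd := hdecr (x k) (hxX k) _ (hxsX _ (hpP k)) _ (hIX (hmaps hP)) (βk k) (hbk k) (by
      rw [hinv₁ _ hP, hGxs _ (hpP k), neg_add]; abel)
    rw [hPc]
    refine ⟨hP, ?_⟩
    have hVk := hVc k
    change _ ≤ _ - βk k * (_ - ω k) at hd
    rcases le_total (c / 2) (Φ (xstar (p k)) - Φ xdag) with h | h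
    · have h4 : κ * (c / 2) ^ 2 ≤ κ * (Φ (xstar (p k)) - Φ xdag) ^ 2 := by gcongr
      have h5 : 0 ≤ βk k * (κ * (Φ (xstar (p k)) - Φ xdag) ^ 2 - ω k) :=
        mul_nonneg (hbk k).le (by linarith)
      linarith
    · have h5 : 0 ≤ βk k * (κ * (Φ (xstar (p k)) - Φ xdag) ^ 2) :=
        mul_nonneg (hbk k).le (by positivity)
      linarith
  have hV : Tendsto (fun k => Φ (xstar (p k)) - Φ xdag) atTop (𝓝 0) := by
    refine tendsto_zero_of_quadratic_drift hκ
      (fun k => sub_nonneg.2 (hmin _ (hxsX _ (hpP k)))) (fun k => (hbk k).le) hb0 hbksum hω0 ?_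
    filter_upwards [haccept] with k hk
    have hpk : p (k + 1) = p k + βk k • gradΦ (x k) := by
      rw [hprec k, Set.indicator_of_mem hk]
    have hd := hdecr (x k) (hxX k) _ (hxsX _ (hpP k)) _ (hxsX _ (hpP (k + 1))) (βk k) (hbk k) (by
      rw [hGxs _ (hpP (k + 1)), hGxs _ (hpP k), hpk, neg_add]; abel)
    change _ ≤ _ - βk k * (_ - ω k) at hd
    linarith
  have hy : Tendsto (fun k => xstar (p k)) atTop (𝓝 xdag) := by
    rw [tendsto_iff_norm_sub_tendsto_zero]
    have hsq' : Tendsto (fun k => ‖xstar (p k) - xdag‖ ^ 2) atTop (𝓝 0) := by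
      refine squeeze_zero (fun k => sq_nonneg _) (fun k => ?_)
        (by simpa using hV.const_mul (4 / μΦ))
      have := hΦconv.mul_norm_sub_sq_le hdagX hmin (hxsX _ (hpP k))
      rw [div_mul_eq_mul_div, le_div_iff₀ hμΦ]
      linarith
    simpa using hsq'.sqrt
  refine ⟨htrack, ?_, ?_⟩
  · have h := ((hGX xdag hdagX).continuousAt.tendsto.comp hy).neg
    refine h.congr fun k => ?_
    simp [hGxs _ (hpP k)]
  · have h := (tendsto_zero_iff_norm_tendsto_zero.2 htrack).add hy
    simpa using h
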